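/- Let KG = ⟨b, c ∣ c b c⁻¹ = b⁻¹⟩ be the Klein bottle group and let ε : KG → ℤ/2ℤ be the unique group homomorphism with ε(b) = 0, ε(c) = 1. Let H = {(n, g) ∈ ℤ × KG : the image of n in ℤ/2ℤ equals ε(g)}. Then H is the subgroup of ℤ × KG generated by the three elements (2, 1), (0, b), (1, c), and H is isomorphic to ℤ × KG. -/

import Mathlib

/-!
STATEMENT 12: Let `KG = ⟨b, c ∣ c b c⁻¹ = b⁻¹⟩` be the Klein bottle group and
`ε : KG → ℤ/2ℤ` the unique homomorphism with `ε(b) = 0`, `ε(c) = 1`.  Let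
`H = {(n, g) ∈ ℤ × KG : n mod 2 = ε(g)}`.  Then `H` is the subgroup of `ℤ × KG` generated
by `(2, 1), (0, b), (1, c)`, and `H ≅ ℤ × KG`.  (The group `ℤ` is written multiplicatively
as `Multiplicative ℤ` so that `ℤ × KG` is a group.)
-/

/-- The relator of the presentation `⟨b, c ∣ c b c⁻¹ = b⁻¹⟩` of the Klein bottle group,
with `b, c` the generators `0, 1`. -/
def kleinRels : Set (FreeGroup (Fin 2)) :=
  {FreeGroup.of 1 * FreeGroup.of 0 * (FreeGroup.of 1)⁻¹ * FreeGroup.of 0}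

/-- The Klein bottle group `KG = ⟨b, c ∣ c b c⁻¹ = b⁻¹⟩`. -/
abbrev KleinGroup : Type := PresentedGroup kleinRels

namespace KleinGroup

/-- The generator `b` of the Klein bottle group. -/
def b : KleinGroup := PresentedGroup.of 0

/-- The generator `c` of the Klein bottle group. -/
def c : KleinGroup := PresentedGroup.of 1

end KleinGroup

/-- Given a homomorphism `ε : KG → ℤ/2ℤ`, the subgroup of `ℤ × KG` of pairs `(n, g)` with
`n ≡ ε g (mod 2)`. -/
def parityGraphSubgroup (ε : KleinGroup →* Multiplicative (ZMod 2)) :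
    Subgroup (Multiplicative ℤ × KleinGroup) where
  carrier := {p | ((Multiplicative.toAdd p.1 : ℤ) : ZMod 2) = Multiplicative.toAdd (ε p.2)}
  one_mem' := by simp
  mul_mem' := by
    intro p q hp hq
    simp only [Set.mem_setOf_eq, Prod.fst_mul, Prod.snd_mul, toAdd_mul, Int.cast_add,
      map_mul] at *
    rw [hp, hq]
  inv_mem' := by
    intro p hp
    simp only [Set.mem_setOf_eq, Prod.fst_inv, Prod.snd_inv, toAdd_inv, Int.cast_neg,
      map_inv] at *
    rw [hp]

namespace KleinGroup

/-- The homomorphism `KG → ℤ` counting the exponent of `c`. -/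
def winding : KleinGroup →* Multiplicative ℤ :=
  PresentedGroup.toGroup (f := ![1, Multiplicative.ofAdd 1]) (by
    rintro r rfl
    simp)

theorem winding_b : winding b = 1 := by
  simp [winding, b]

theorem winding_c : winding c = Multiplicative.ofAdd 1 := by
  simp [winding, c]

theorem eq_top_of_mem {K : Subgroup KleinGroup} (hb : b ∈ K) (hc : c ∈ K) : K = ⊤ := by
  rw [eq_top_iff, ← PresentedGroup.closure_range_of, Subgroup.closure_le]
  rintro _ ⟨i, rfl⟩
  fin_cases i
  · exact hb
  · exact hc

theorem hom_eq_winding_mod_two (ε : KleinGroup →* Multiplicative (ZMod 2))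
    (hb : ε b = Multiplicative.ofAdd (0 : ZMod 2))
    (hc : ε c = Multiplicative.ofAdd (1 : ZMod 2)) (g : KleinGroup) :
    Multiplicative.toAdd (ε g) = ((Multiplicative.toAdd (winding g) : ℤ) : ZMod 2) := by
  have key : ε = (AddMonoidHom.toMultiplicative (Int.castAddHom (ZMod 2))).comp winding := by
    refine PresentedGroup.ext fun i => ?_
    fin_cases i
    · change ε b = AddMonoidHom.toMultiplicative (Int.castAddHom (ZMod 2)) (winding b)
      rw [hb, winding_b, map_one, ofAdd_zero]
    · change ε c = AddMonoidHom.toMultiplicative (Int.castAddHom (ZMod 2)) (winding c)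
      rw [hc, winding_c]
      simp
  rw [key]
  rfl

/-- The endomorphism `(m, g) ↦ (2 m + winding g, g)` of `ℤ × KG`. -/
def shear : Multiplicative ℤ × KleinGroup →* Multiplicative ℤ × KleinGroup :=
  MonoidHom.prod
    ((powMonoidHom 2).comp (MonoidHom.fst _ _) * winding.comp (MonoidHom.snd _ _))
    (MonoidHom.snd _ _)

theorem shear_apply (p : Multiplicative ℤ × KleinGroup) :
    shear p = (p.1 ^ 2 * winding p.2, p.2) := rfl

theorem shear_injective : Function.Injective shear := by
  rintro ⟨m, g⟩ ⟨n, h⟩ e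
  simp only [shear_apply, Prod.mk.injEq] at e
  obtain ⟨e, rfl⟩ := e
  have e' := congrArg Multiplicative.toAdd (mul_right_cancel e)
  simp only [toAdd_pow, nsmul_eq_mul] at e'
  refine Prod.ext (Multiplicative.toAdd.injective ?_) rfl
  push_cast at e'
  dsimp only
  linarith

theorem range_shear (ε : KleinGroup →* Multiplicative (ZMod 2))
    (hb : ε b = Multiplicative.ofAdd (0 : ZMod 2))
    (hc : ε c = Multiplicative.ofAdd (1 : ZMod 2)) :
    shear.range = parityGraphSubgroup ε := by
  ext ⟨n, g⟩
  change _ ↔ ((Multiplicative.toAdd n : ℤ) : ZMod 2) = Multiplicative.toAdd (ε g)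
  rw [hom_eq_winding_mod_two ε hb hc, eq_comm, ZMod.intCast_eq_intCast_iff_dvd_sub]
  constructor
  · rintro ⟨⟨m, h⟩, e⟩
    simp only [shear_apply, Prod.mk.injEq] at e
    obtain ⟨rfl, rfl⟩ := e
    refine ⟨Multiplicative.toAdd m, ?_⟩
    simp
  · rintro ⟨m, e⟩
    refine ⟨(Multiplicative.ofAdd m, g), Prod.ext (Multiplicative.toAdd.injective ?_) rfl⟩
    simp only [shear_apply, toAdd_mul, toAdd_pow, toAdd_ofAdd, nsmul_eq_mul]
    linarith

theorem range_shear_eq_closure :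
    shear.range = Subgroup.closure
        {(Multiplicative.ofAdd (2 : ℤ), (1 : KleinGroup)),
         (Multiplicative.ofAdd (0 : ℤ), b),
         (Multiplicative.ofAdd (1 : ℤ), c)} := by
  set K : Subgroup (Multiplicative ℤ × KleinGroup) := Subgroup.closure _ with hK
  have h_two : shear (Multiplicative.ofAdd 1, 1) = (Multiplicative.ofAdd (2 : ℤ), 1) := by
    rw [shear_apply, winding.map_one, mul_one]
    rfl
  have h_b : shear (1, b) = (Multiplicative.ofAdd (0 : ℤ), b) := by
    rw [shear_apply, winding_b]
    rfl
  have h_c : shear (1, c) = (Multiplicative.ofAdd (1 : ℤ), c) := by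
    rw [shear_apply, winding_c]
    rfl
  apply le_antisymm
  · have h_right : (K.comap shear).comap (MonoidHom.inr _ _) = ⊤ := by
      apply eq_top_of_mem
      · change shear (1, b) ∈ K
        rw [h_b]
        exact Subgroup.subset_closure (by simp)
      · change shear (1, c) ∈ K
        rw [h_c]
        exact Subgroup.subset_closure (by simp)
    have h_left : (Multiplicative.ofAdd (1 : ℤ), (1 : KleinGroup)) ∈ K.comap shear := by
      change shear _ ∈ K
      rw [h_two]
      exact Subgroup.subset_closure (by simp)
    rintro _ ⟨⟨m, g⟩, rfl⟩
    have h_g : ((1 : Multiplicative ℤ), g) ∈ K.comap shear :=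
      (h_right ▸ Subgroup.mem_top g : g ∈ (K.comap shear).comap (MonoidHom.inr _ _))
    have h_prod := mul_mem (zpow_mem h_left (Multiplicative.toAdd m)) h_g
    have e : (Multiplicative.ofAdd (1 : ℤ), (1 : KleinGroup)) ^ (Multiplicative.toAdd m) * (1, g)
        = (m, g) := by
      refine Prod.ext (Multiplicative.toAdd.injective ?_) ?_ <;> simp
    rwa [e] at h_prod
  · rw [hK, Subgroup.closure_le]
    rintro _ (rfl | rfl | rfl)
    · exact ⟨_, h_two⟩
    · exact ⟨_, h_b⟩
    · exact ⟨_, h_c⟩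

end KleinGroup

theorem parityGraphSubgroup_gens_and_iso (ε : KleinGroup →* Multiplicative (ZMod 2))
    (hb : ε KleinGroup.b = Multiplicative.ofAdd (0 : ZMod 2))
    (hc : ε KleinGroup.c = Multiplicative.ofAdd (1 : ZMod 2)) :
    parityGraphSubgroup ε = Subgroup.closure
        {(Multiplicative.ofAdd (2 : ℤ), (1 : KleinGroup)),
         (Multiplicative.ofAdd (0 : ℤ), KleinGroup.b),
         (Multiplicative.ofAdd (1 : ℤ), KleinGroup.c)} ∧
      Nonempty (parityGraphSubgroup ε ≃* Multiplicative ℤ × KleinGroup) := by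
  have h := KleinGroup.range_shear ε hb hc
  refine ⟨h.symm.trans KleinGroup.range_shear_eq_closure, ?_⟩
  rw [← h]
  exact ⟨(MonoidHom.ofInjective KleinGroup.shear_injective).symm⟩
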